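/- Let F satisfy (SH) and (H1) and let φ:ℝⁿ→ℝ be locally Lipschitz. Let x̄:[t₀,T]→ℝⁿ be an optimal solution of the Mayer problem P(t₀,x₀) and let p̄:[t₀,T]→ℝⁿ be any absolutely continuous arc satisfying −p̄'(t) ∈ ∂ₓ⁻H(x̄(t),p̄(t)) and x̄'(t) ∈ ∂ₚH(x̄(t),p̄(t)) for a.e. t ∈ [t₀,T], together with the transversality condition −p̄(T) ∈ ∂^{+,pr}φ(x̄(T)). Then there exist constants c₀, r > 0 such that for all t ∈ [t₀,T] and all h with |h| ≤ r, V(t, x̄(t)+h) − V(t, x̄(t)) ≤ ⟨−p̄(t), h⟩ + c₀|h|². Consequently −p̄(t) ∈ ∂ₓ^{+,pr}V(t, x̄(t)) for all t ∈ [t₀,T] (proximal partial sensitivity relation). -/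

import Mathlib

open MeasureTheory Filter Metric Set Topology
open scoped RealInnerProductSpace ENNReal NNReal Pointwise

noncomputable section

variable {E : Type*} [NormedAddCommGroup E] [InnerProductSpace ℝ E] [CompleteSpace E]

/-- The Hamiltonian `H(x,p) = sup_{v ∈ F x} ⟪v,p⟫` associated with `F`. -/
def Ham (F : E → Set E) (x p : E) : ℝ :=
  sSup ((fun v => ⟪v, p⟫) '' F x)

/-- Standing hypotheses (SH): nonempty convex compact values, local Lipschitz continuity
with respect to the Hausdorff metric, and sublinear growth. -/
def StandingHyp (F : E → Set E) : Prop :=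
  (∀ x, (F x).Nonempty ∧ Convex ℝ (F x) ∧ IsCompact (F x)) ∧
  (∀ x : E, ∃ ε > (0:ℝ), ∃ c : ℝ, 0 ≤ c ∧ ∀ y ∈ ball x ε, ∀ z ∈ ball x ε,
    EMetric.hausdorffEdist (F y) (F z) ≤ ENNReal.ofReal (c * dist y z)) ∧
  (∃ r > (0:ℝ), ∀ x : E, ∀ v ∈ F x, ‖v‖ ≤ r * (1 + ‖x‖))

/-- `f` is semiconvex on `K` with constant `c`. -/
def SemiconvexWith (f : E → ℝ) (K : Set E) (c : ℝ) : Prop :=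
  ∀ x h : E, x + h ∈ K → x - h ∈ K → -(c * ‖h‖ ^ 2) ≤ f (x + h) + f (x - h) - 2 * f x

/-- `f` is semiconcave on `K` with constant `c`. -/
def SemiconcaveWith (f : E → ℝ) (K : Set E) (c : ℝ) : Prop :=
  ∀ x h : E, x + h ∈ K → x - h ∈ K → f (x + h) + f (x - h) - 2 * f x ≤ c * ‖h‖ ^ 2

def LocSemiconcave (f : E → ℝ) : Prop :=
  ∀ x : E, ∃ ε > (0:ℝ), ∃ c : ℝ, SemiconcaveWith f (ball x ε) c

def LocSemiconvex (f : E → ℝ) : Prop :=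
  ∀ x : E, ∃ ε > (0:ℝ), ∃ c : ℝ, SemiconvexWith f (ball x ε) c

open scoped Classical in
/-- The gradient `∇ₚH(x,p)` of `H(x,·)` at `p` (junk value `0` if it does not exist). -/
def gradpH (F : E → Set E) (x p : E) : E :=
  if h : ∃ g, HasGradientAt (fun q => Ham F x q) g p then h.choose else 0

/-- Hypothesis (H1): semiconvexity of `H(·,p)` with constant `c‖p‖` on compact convex sets,
existence of `∇ₚH(x,p)` for `p ≠ 0`, and local Lipschitz continuity of `x ↦ ∇ₚH(x,p)`,
uniformly for `p` in compact subsets of `ℝⁿ ∖ {0}`. -/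
def HypH1 (F : E → Set E) : Prop :=
  (∀ K : Set E, K.Nonempty → Convex ℝ K → IsCompact K →
    ∃ c : ℝ, 0 ≤ c ∧ ∀ p : E, SemiconvexWith (fun x => Ham F x p) K (c * ‖p‖)) ∧
  (∀ x p : E, p ≠ 0 → HasGradientAt (fun q => Ham F x q) (gradpH F x p) p) ∧
  (∀ K : Set E, K.Nonempty → Convex ℝ K → IsCompact K →
    ∀ P : Set E, IsCompact P → (0:E) ∉ P →
      ∃ L : ℝ≥0, ∀ p ∈ P, LipschitzOnWith L (fun x => gradpH F x p) K)

/-- Fréchet subdifferential `∂⁻f(x)`. -/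
def FSub (f : E → ℝ) (x : E) : Set E :=
  {p | ∀ ε > (0:ℝ), ∀ᶠ y in 𝓝 x, -(ε * ‖y - x‖) ≤ f y - f x - ⟪p, y - x⟫}

/-- Fréchet superdifferential `∂⁺f(x)`. -/
def FSuper (f : E → ℝ) (x : E) : Set E :=
  {p | ∀ ε > (0:ℝ), ∀ᶠ y in 𝓝 x, f y - f x - ⟪p, y - x⟫ ≤ ε * ‖y - x‖}

/-- Proximal superdifferential `∂^{+,pr}f(x)`. -/
def ProxSuper (f : E → ℝ) (x : E) : Set E :=
  {p | ∃ c : ℝ, 0 ≤ c ∧ ∃ ρ > (0:ℝ), ∀ y ∈ closedBall x ρ,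
    f y - f x - ⟪p, y - x⟫ ≤ c * ‖y - x‖ ^ 2}

/-- Clarke's generalized gradient of `f` at `x`:
`ζ ∈ ∂f(x)` iff `⟪ζ,v⟫ ≤ limsup_{y→x, h→0⁺} (f(y+hv)-f(y))/h` for all `v`. -/
def ClarkeGrad (f : E → ℝ) (x : E) : Set E :=
  {ζ | ∀ v : E, ∀ ε > (0:ℝ),
    ∃ᶠ q : E × ℝ in (𝓝 x) ×ˢ (𝓝[>] (0:ℝ)),
      ⟪ζ, v⟫ - ε ≤ (f (q.1 + q.2 • v) - f q.1) / q.2}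

/-- `x` is absolutely continuous on `[t0,T]` with (a.e.) derivative `x'`. -/
def ACArc (t0 T : ℝ) (x x' : ℝ → E) : Prop :=
  IntervalIntegrable x' volume t0 T ∧
  (∀ s ∈ Icc t0 T, x s = x t0 + ∫ r in t0..s, x' r) ∧
  (∀ᵐ s ∂volume, s ∈ Icc t0 T → HasDerivAt x (x' s) s)

/-- `x` is a trajectory of the differential inclusion `x' ∈ F(x)` on `[t0,T]`. -/
def IsTraj (F : E → Set E) (t0 T : ℝ) (x x' : ℝ → E) : Prop :=
  ACArc t0 T x x' ∧ ∀ᵐ s ∂volume, s ∈ Icc t0 T → x' s ∈ F (x s)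

/-- `x` is an optimal trajectory for the Mayer problem `P(t0,x0)`. -/
def IsOptimal (F : E → Set E) (φ : E → ℝ) (t0 T : ℝ) (x0 : E) (x x' : ℝ → E) : Prop :=
  IsTraj F t0 T x x' ∧ x t0 = x0 ∧
  ∀ y y' : ℝ → E, IsTraj F t0 T y y' → y t0 = x0 → φ (x T) ≤ φ (y T)

/-- The value function of the Mayer problem. -/
def valueFn (F : E → Set E) (φ : E → ℝ) (T t : ℝ) (x : E) : ℝ :=
  sInf {r | ∃ y y' : ℝ → E, IsTraj F t T y y' ∧ y t = x ∧ r = φ (y T)}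

/-- Fréchet superdifferential of `W` in the pair `(t,x)`. -/
def FSuperPair (W : ℝ → E → ℝ) (t : ℝ) (x : E) : Set (ℝ × E) :=
  {q | ∀ ε > (0:ℝ), ∀ᶠ sy : ℝ × E in 𝓝 (t, x),
    W sy.1 sy.2 - W t x - q.1 * (sy.1 - t) - ⟪q.2, sy.2 - x⟫ ≤
      ε * ‖((sy.1 - t, sy.2 - x) : ℝ × E)‖}

/-- Fréchet subdifferential of `W` in the pair `(t,x)`. -/
def FSubPair (W : ℝ → E → ℝ) (t : ℝ) (x : E) : Set (ℝ × E) :=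
  {q | ∀ ε > (0:ℝ), ∀ᶠ sy : ℝ × E in 𝓝 (t, x),
    -(ε * ‖((sy.1 - t, sy.2 - x) : ℝ × E)‖) ≤
      W sy.1 sy.2 - W t x - q.1 * (sy.1 - t) - ⟪q.2, sy.2 - x⟫}

/-- Proximal superdifferential of `W` in the pair `(t,x)`. -/
def ProxSuperPair (W : ℝ → E → ℝ) (t : ℝ) (x : E) : Set (ℝ × E) :=
  {q | ∃ c : ℝ, 0 ≤ c ∧ ∃ ρ > (0:ℝ), ∀ s : ℝ, ∀ y : E,
    dist ((s, y) : ℝ × E) ((t, x) : ℝ × E) ≤ ρ →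
      W s y - W t x - q.1 * (s - t) - ⟪q.2, y - x⟫ ≤ c * ‖((s - t, y - x) : ℝ × E)‖ ^ 2}

/-- `V` is differentiable at `(t,x)` with (pair) gradient `q = (∂ₜV, ∇ₓV)`. -/
def HasGradPair (W : ℝ → E → ℝ) (t : ℝ) (x : E) (q : ℝ × E) : Prop :=
  HasFDerivAt (fun sy : ℝ × E => W sy.1 sy.2)
    (q.1 • ContinuousLinearMap.fst ℝ ℝ E +
      (innerSL ℝ q.2).comp (ContinuousLinearMap.snd ℝ ℝ E)) (t, x)

/-- The reachable (limiting) gradient `∂*W(t,x)`. -/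
def ReachGradPair (W : ℝ → E → ℝ) (t : ℝ) (x : E) : Set (ℝ × E) :=
  {q | ∃ u g : ℕ → ℝ × E,
    (∀ i, HasGradPair W (u i).1 (u i).2 (g i)) ∧
    Tendsto u atTop (𝓝 (t, x)) ∧ Tendsto g atTop (𝓝 q)}

/-- Normal cone (of convex analysis) to `A` at `z`. -/
def normalConeAt (A : Set E) (z : E) : Set E :=
  {p | ∀ v ∈ A, ⟪p, v - z⟫ ≤ 0}

/-- `A` is `R`-convex. -/
def RConvex (A : Set E) (R : ℝ) : Prop :=
  ∀ z ∈ frontier A, ∀ y ∈ frontier A, ∀ n ∈ normalConeAt A z, ∀ m ∈ normalConeAt A y,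
    ‖n‖ = 1 → ‖m‖ = 1 → ‖z - y‖ ≤ R * ‖n - m‖

/-- `F` is locally strongly convex. -/
def LocStronglyConvex (F : E → Set E) : Prop :=
  ∀ K : Set E, IsCompact K → ∃ R > (0:ℝ), ∀ x ∈ K, RConvex (F x) R

/-- `ℝⁿ` as a Euclidean space. -/
abbrev Euc (n : ℕ) : Type := EuclideanSpace ℝ (Fin n)

set_option linter.unusedSectionVars false

open scoped Classical in
/-- The point of `A` nearest to `v`, given by its variational characterization
(junk value `0` if there is none). -/
def nearestPt (A : Set E) (v : E) : E :=
  if h : ∃ u ∈ A, ∀ w ∈ A, ⟪v - u, w - u⟫ ≤ 0 then h.choose else 0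

lemma nearestPt_spec {A : Set E} (hne : A.Nonempty) (hconv : Convex ℝ A) (hcomp : IsCompact A)
    (v : E) : nearestPt A v ∈ A ∧ ∀ w ∈ A, ⟪v - nearestPt A v, w - nearestPt A v⟫ ≤ 0 := by
  have h : ∃ u ∈ A, ∀ w ∈ A, ⟪v - u, w - u⟫ ≤ 0 := by
    obtain ⟨u, hu, hu'⟩ := exists_norm_eq_iInf_of_complete_convex hne hcomp.isComplete hconv v
    exact ⟨u, hu, (norm_eq_iInf_iff_real_inner_le_zero hconv hu).1 hu'⟩
  rw [nearestPt, dif_pos h]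
  exact h.choose_spec

lemma norm_sub_nearestPt_le {A : Set E} (hne : A.Nonempty) (hconv : Convex ℝ A)
    (hcomp : IsCompact A) (v : E) {w : E} (hw : w ∈ A) : ‖v - nearestPt A v‖ ≤ ‖v - w‖ := by
  have h := (nearestPt_spec hne hconv hcomp v).2 w hw
  set u := nearestPt A v
  have h1 : v - w = (v - u) - (w - u) := by abel
  have h2 := norm_sub_sq_real (v - u) (w - u)
  rw [← h1] at h2
  apply le_of_sq_le_sq _ (norm_nonneg _)
  nlinarith [sq_nonneg ‖w - u‖]

lemma nearestPt_of_mem {A : Set E} (hne : A.Nonempty) (hconv : Convex ℝ A)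
    (hcomp : IsCompact A) {v : E} (hv : v ∈ A) : nearestPt A v = v := by
  have h := norm_sub_nearestPt_le hne hconv hcomp v hv
  rw [sub_self, norm_zero] at h
  exact (sub_eq_zero.1 (norm_le_zero_iff.1 h)).symm

lemma norm_nearestPt_sub_nearestPt_le {A : Set E} (hne : A.Nonempty) (hconv : Convex ℝ A)
    (hcomp : IsCompact A) (v w : E) : ‖nearestPt A v - nearestPt A w‖ ≤ ‖v - w‖ := by
  obtain ⟨hu, hu'⟩ := nearestPt_spec hne hconv hcomp v
  obtain ⟨hz, hz'⟩ := nearestPt_spec hne hconv hcomp w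
  set u := nearestPt A v
  set z := nearestPt A w
  have h1 := hu' z hz
  have h2 := hz' u hu
  have h3 : ‖u - z‖ ^ 2 = ⟪v - w, u - z⟫ + ⟪v - u, z - u⟫ + ⟪w - z, u - z⟫ := by
    rw [← real_inner_self_eq_norm_sq, ← neg_sub u z, inner_neg_right, ← sub_eq_add_neg,
      ← inner_sub_left, ← inner_add_left]
    congr 1
    abel
  have h4 := real_inner_le_norm (v - w) (u - z)
  by_contra! hlt
  nlinarith [norm_nonneg (v - w), norm_nonneg (u - z)]

/-- Stability of the nearest point under perturbations of the set. -/
lemma norm_nearestPt_sub_sq_le {A B : Set E} (hA : A.Nonempty) (hAconv : Convex ℝ A)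
    (hAcomp : IsCompact A) (hB : B.Nonempty) (hBconv : Convex ℝ B) (hBcomp : IsCompact B)
    {δ : ℝ} (hAB : ∀ a ∈ A, ∃ b ∈ B, ‖a - b‖ ≤ δ) (hBA : ∀ b ∈ B, ∃ a ∈ A, ‖b - a‖ ≤ δ)
    (v : E) : ‖nearestPt A v - nearestPt B v‖ ^ 2 ≤ δ * (2 * ‖v - nearestPt B v‖ + δ) := by
  obtain ⟨hu, hu'⟩ := nearestPt_spec hA hAconv hAcomp v
  obtain ⟨hz, hz'⟩ := nearestPt_spec hB hBconv hBcomp v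
  obtain ⟨b, hb, hub⟩ := hAB _ hu
  obtain ⟨a, ha, hza⟩ := hBA _ hz
  have hva := norm_sub_nearestPt_le hA hAconv hAcomp v ha
  set u := nearestPt A v
  set z := nearestPt B v
  have h1 := hu' a ha
  have h2 := hz' b hb
  have h3 : ‖u - z‖ ^ 2 = ⟪v - u, a - u⟫ + ⟪v - z, b - z⟫ + ⟪v - u, z - a⟫
      + ⟪v - z, u - b⟫ := by
    rw [← real_inner_self_eq_norm_sq]
    have e1 : ⟪v - u, z - u⟫ = ⟪v - u, a - u⟫ + ⟪v - u, z - a⟫ := by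
      rw [← inner_add_right]; congr 1; abel
    have e2 : ⟪v - z, u - z⟫ = ⟪v - z, b - z⟫ + ⟪v - z, u - b⟫ := by
      rw [← inner_add_right]; congr 1; abel
    have e3 : ⟪u - z, u - z⟫ = ⟪v - u, z - u⟫ + ⟪v - z, u - z⟫ := by
      rw [← neg_sub u z, inner_neg_right, neg_add_eq_sub, ← inner_sub_left]
      congr 1; abel
    linarith
  have h4 := real_inner_le_norm (v - u) (z - a)
  have h5 := real_inner_le_norm (v - z) (u - b)
  have h6 : ‖v - a‖ ≤ ‖v - z‖ + ‖z - a‖ := norm_sub_le_norm_sub_add_norm_sub v z a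
  have hδ : 0 ≤ δ := (norm_nonneg _).trans hub
  have h7 : ‖v - u‖ * ‖z - a‖ ≤ (‖v - z‖ + δ) * δ :=
    mul_le_mul (by linarith) hza (norm_nonneg _) (by positivity)
  have h8 : ‖v - z‖ * ‖u - b‖ ≤ ‖v - z‖ * δ := mul_le_mul_of_nonneg_left hub (norm_nonneg _)
  nlinarith

/-- A set-valued map with nonempty convex compact values is `L`-Lipschitz on `K`. -/
def SetLipOn (G : E → Set E) (K : Set E) (L : ℝ) : Prop :=
  ∀ x ∈ K, ∀ y ∈ K, ∀ v ∈ G x, ∃ w ∈ G y, ‖v - w‖ ≤ L * ‖x - y‖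

lemma SetLipOn.continuous_nearestPt {G : E → Set E} {L : ℝ} (hG : SetLipOn G univ L)
    (hval : ∀ x, (G x).Nonempty ∧ Convex ℝ (G x) ∧ IsCompact (G x)) :
    Continuous fun q : E × E => nearestPt (G q.1) q.2 := by
  refine continuous_prod_of_continuous_lipschitzWith' _ 1 (fun x => ?_) (fun v => ?_)
  · refine LipschitzWith.of_dist_le_mul fun v w => ?_
    obtain ⟨h1, h2, h3⟩ := hval x
    simpa [dist_eq_norm] using norm_nearestPt_sub_nearestPt_le h1 h2 h3 v w
  · refine continuous_iff_continuousAt.2 fun x0 => ?_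
    obtain ⟨b1, b2, b3⟩ := hval x0
    have key : ∀ x, ‖nearestPt (G x) v - nearestPt (G x0) v‖ ≤
        √(L * ‖x - x0‖ * (2 * ‖v - nearestPt (G x0) v‖ + L * ‖x - x0‖)) := fun x => by
      obtain ⟨a1, a2, a3⟩ := hval x
      refine Real.le_sqrt_of_sq_le (norm_nearestPt_sub_sq_le a1 a2 a3 b1 b2 b3
        (hG x trivial x0 trivial) ?_ v)
      rw [norm_sub_rev]
      exact hG x0 trivial x trivial
    have hlim : Tendsto (fun x => √(L * ‖x - x0‖ *
        (2 * ‖v - nearestPt (G x0) v‖ + L * ‖x - x0‖))) (𝓝 x0) (𝓝 0) :=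
      Continuous.tendsto' (by fun_prop) _ _ (by simp)
    refine tendsto_iff_norm_sub_tendsto_zero.2 ?_
    exact squeeze_zero (fun _ => norm_nonneg _) key hlim

lemma StandingHyp.exists_setLipOn {F : E → Set E} (hF : StandingHyp F) {K : Set E}
    (hK : IsCompact K) : ∃ L : ℝ, 0 ≤ L ∧ SetLipOn F K L := by
  obtain ⟨hval, hlip, -⟩ := hF
  let G : E → TopologicalSpace.NonemptyCompacts E := fun x =>
    ⟨⟨F x, (hval x).2.2⟩, (hval x).1⟩
  have hG : LocallyLipschitz G := fun x => by
    obtain ⟨ε, hε, c, hc, h⟩ := hlip x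
    refine ⟨c.toNNReal, ball x ε, ball_mem_nhds x hε, fun y hy z hz => ?_⟩
    have := h y hy z hz
    rw [ENNReal.ofReal_mul hc, ← edist_dist] at this
    exact this
  obtain ⟨L, hL⟩ := hG.locallyLipschitzOn.exists_lipschitzOnWith_of_compact hK
  refine ⟨L, L.2, fun x hx y hy v hv => ?_⟩
  obtain ⟨w, hw, hvw⟩ := (hval y).2.2.exists_infDist_eq_dist (hval y).1 v
  refine ⟨w, hw, ?_⟩
  rw [← dist_eq_norm, ← hvw, ← dist_eq_norm]
  refine le_trans ?_ (hL.dist_le_mul x hx y hy)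
  refine infDist_le_hausdorffDist_of_mem hv ?_
  exact hausdorffEDist_ne_top_of_nonempty_of_bounded (hval x).1 (hval y).1
    (hval x).2.2.isBounded (hval y).2.2.isBounded

lemma integral_mul_exp_sub (L t s : ℝ) :
    ∫ r in t..s, L * Real.exp (2 * L * (r - t)) = (Real.exp (2 * L * (s - t)) - 1) / 2 := by
  have hderiv : ∀ r ∈ uIcc t s, HasDerivAt (fun r => Real.exp (2 * L * (r - t)) / 2)
      (L * Real.exp (2 * L * (r - t))) r := fun r _ => by
    have h1 : HasDerivAt (fun r => 2 * L * (r - t)) (2 * L) r := by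
      simpa using ((hasDerivAt_id r).sub_const t).const_mul (2 * L)
    convert! h1.exp.div_const 2 using 1
    ring
  rw [intervalIntegral.integral_eq_sub_of_hasDerivAt hderiv
    (Continuous.intervalIntegrable (by fun_prop) _ _)]
  simp
  ring

/-- An integral form of Gronwall's inequality. -/
lemma le_two_mul_exp_of_le_add_integral {f : ℝ → ℝ} {a b A C : ℝ} (hab : a ≤ b)
    (hf : ContinuousOn f (Icc a b)) (hC : 0 ≤ C) (hA : 0 ≤ A)
    (h : ∀ s ∈ Icc a b, f s ≤ A + C * ∫ r in a..s, f r) :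
    ∀ s ∈ Icc a b, f s ≤ 2 * A * Real.exp (2 * C * (s - a)) := by
  obtain ⟨m, hm, hmax⟩ := isCompact_Icc.exists_isMaxOn (nonempty_Icc.2 hab)
    (f := fun s => f s * Real.exp (-(2 * C * (s - a)))) (hf.mul (by fun_prop))
  set M := f m * Real.exp (-(2 * C * (m - a))) with hM
  have hexp : ∀ s, Real.exp (-(2 * C * (s - a))) * Real.exp (2 * C * (s - a)) = 1 := fun s => by
    rw [← Real.exp_add]; simp
  have hle : ∀ s ∈ Icc a b, f s ≤ M * Real.exp (2 * C * (s - a)) := fun s hs => by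
    have h1 : f s * Real.exp (-(2 * C * (s - a))) ≤ M := hmax hs
    calc f s = f s * Real.exp (-(2 * C * (s - a))) * Real.exp (2 * C * (s - a)) := by
          rw [mul_assoc, hexp, mul_one]
      _ ≤ _ := mul_le_mul_of_nonneg_right h1 (Real.exp_pos _).le
  have hfm : f m = M * Real.exp (2 * C * (m - a)) := by rw [hM, mul_assoc, hexp, mul_one]
  have hint : ∫ r in a..m, f r ≤ ∫ r in a..m, M * Real.exp (2 * C * (r - a)) := by
    refine intervalIntegral.integral_mono_on hm.1 ?_
      (Continuous.intervalIntegrable (by fun_prop) _ _) fun r hr => hle r ⟨hr.1, hr.2.trans hm.2⟩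
    refine ContinuousOn.intervalIntegrable (hf.mono ?_)
    rw [uIcc_of_le hm.1]
    exact Icc_subset_Icc_right hm.2
  have h2 : C * ∫ r in a..m, M * Real.exp (2 * C * (r - a))
      = M * ((Real.exp (2 * C * (m - a)) - 1) / 2) := by
    rw [← integral_mul_exp_sub, ← intervalIntegral.integral_const_mul,
      ← intervalIntegral.integral_const_mul]
    congr 1; ext r; ring
  have h3 := h m hm
  have h4 := mul_le_mul_of_nonneg_left hint hC
  have h5 : 1 ≤ Real.exp (2 * C * (m - a)) :=
    Real.one_le_exp (mul_nonneg (by positivity) (by linarith [hm.1]))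
  have hMA : M ≤ 2 * A := by
    by_contra! hlt
    nlinarith
  exact fun s hs => (hle s hs).trans (mul_le_mul_of_nonneg_right hMA (Real.exp_pos _).le)

section Arcs

variable {t T : ℝ} {x x' : ℝ → E}

lemma ACArc.intervalIntegrable (h : ACArc t T x x') {a b : ℝ} (ha : a ∈ Icc t T)
    (hb : b ∈ Icc t T) : IntervalIntegrable x' volume a b :=
  h.1.mono_set (by
    rw [uIcc_of_le (ha.1.trans ha.2)]
    exact uIcc_subset_Icc ha hb)

lemma ACArc.sub_eq_integral (h : ACArc t T x x') {a b : ℝ} (ha : a ∈ Icc t T)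
    (hb : b ∈ Icc t T) : x b - x a = ∫ r in a..b, x' r := by
  have ht : t ∈ Icc t T := ⟨le_rfl, ha.1.trans ha.2⟩
  rw [h.2.1 b hb, h.2.1 a ha, add_sub_add_left_eq_sub,
    intervalIntegral.integral_interval_sub_left (h.intervalIntegrable ht hb)
      (h.intervalIntegrable ht ha)]

lemma ACArc.continuousOn (h : ACArc t T x x') : ContinuousOn x (Icc t T) := by
  rcases le_or_gt t T with htT | htT
  · have h1 : ContinuousOn (fun s => x t + ∫ r in t..s, x' r) (Icc t T) := by
      refine continuousOn_const.add ?_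
      rw [← uIcc_of_le htT]
      exact intervalIntegral.continuousOn_primitive_interval' h.1 left_mem_uIcc
    exact h1.congr h.2.1
  · simp [Icc_eq_empty_of_lt htT]

lemma ACArc.restrict (h : ACArc t T x x') {a : ℝ} (ha : a ∈ Icc t T) : ACArc a T x x' := by
  have hsub : Icc a T ⊆ Icc t T := Icc_subset_Icc_left ha.1
  refine ⟨h.intervalIntegrable ha ⟨ha.1.trans ha.2, le_rfl⟩, fun s hs => ?_, ?_⟩
  · rw [← h.sub_eq_integral ha (hsub hs)]; abel
  · filter_upwards [h.2.2] with s hs hs' using hs (hsub hs')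

lemma ACArc.of_integral (htT : t ≤ T) (a : E) (hx' : IntervalIntegrable x' volume t T) :
    ACArc t T (fun s => a + ∫ r in t..s, x' r) x' := by
  refine ⟨hx', fun s _ => by simp, ?_⟩
  filter_upwards [hx'.ae_hasDerivAt_integral] with s hs hs'
  rw [uIcc_of_le htT] at hs
  exact (hs hs' t ⟨le_rfl, htT⟩).const_add a

lemma ACArc.norm_sub_le (h : ACArc t T x x') {B : ℝ} (hB : ∀ᵐ s, s ∈ Icc t T → ‖x' s‖ ≤ B)
    {a b : ℝ} (ha : a ∈ Icc t T) (hb : b ∈ Icc t T) : ‖x b - x a‖ ≤ B * |b - a| := by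
  rw [h.sub_eq_integral ha hb]
  refine intervalIntegral.norm_integral_le_of_norm_le_const_ae ?_
  filter_upwards [hB] with s hs hs'
  exact hs (uIcc_subset_Icc ha hb (uIoc_subset_uIcc hs'))

/-- Concatenation of two arcs meeting at time `a`. -/
lemma ACArc.concat {a : ℝ} {y y' : ℝ → E} (h : ACArc t T x x') (ha : a ∈ Icc t T)
    (hy : ACArc a T y y') (hxy : y a = x a) :
    ACArc t T (fun s => if s ≤ a then x s else y s) (fun s => if s ≤ a then x' s else y' s) := by
  have ht : t ∈ Icc t T := ⟨le_rfl, ha.1.trans ha.2⟩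
  have i1 : IntervalIntegrable (fun s => if s ≤ a then x' s else y' s) volume t a := by
    refine (h.intervalIntegrable ht ha).congr fun s hs => ?_
    rw [uIoc_of_le ha.1] at hs
    simp [hs.2]
  have i2 : IntervalIntegrable (fun s => if s ≤ a then x' s else y' s) volume a T := by
    refine hy.1.congr fun s hs => ?_
    rw [uIoc_of_le ha.2] at hs
    simp [hs.1.not_ge]
  have e1 : ∀ s ∈ Icc t a, ∫ r in t..s, (if r ≤ a then x' r else y' r) = ∫ r in t..s, x' r :=
    fun s hs => by
      refine intervalIntegral.integral_congr fun r hr => ?_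
      rw [uIcc_of_le hs.1] at hr
      simp [hr.2.trans hs.2]
  refine ⟨i1.trans i2, fun s hs => ?_, ?_⟩
  · simp only [ha.1, if_true]
    by_cases hsa : s ≤ a
    · rw [e1 s ⟨hs.1, hsa⟩, if_pos hsa, h.2.1 s hs]
    · have hsa' : a ≤ s := (not_le.1 hsa).le
      have i3 : IntervalIntegrable (fun s => if s ≤ a then x' s else y' s) volume a s :=
        i2.mono_set (by
          rw [uIcc_of_le ha.2, uIcc_of_le hsa']
          exact Icc_subset_Icc_right hs.2)
      rw [if_neg hsa, ← intervalIntegral.integral_add_adjacent_intervals i1 i3,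
        e1 a ⟨ha.1, le_rfl⟩, ← add_assoc, ← h.2.1 a ha, ← hxy, hy.2.1 s ⟨hsa', hs.2⟩]
      congr 1
      refine intervalIntegral.integral_congr_ae (ae_of_all _ fun r hr => ?_)
      rw [uIoc_of_le hsa'] at hr
      simp [hr.1.not_ge]
  · have hne : ∀ᵐ s : ℝ, s ≠ a := by simp [ae_iff]
    filter_upwards [h.2.2, hy.2.2, hne] with s h1 h2 hsa hs
    rcases lt_or_gt_of_ne hsa with hlt | hgt
    · rw [if_pos hlt.le]
      refine (h1 hs).congr_of_eventuallyEq ?_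
      filter_upwards [Iio_mem_nhds hlt] with r hr
      exact if_pos (le_of_lt hr)
    · rw [if_neg hgt.not_ge]
      refine (h2 ⟨hgt.le, hs.2⟩).congr_of_eventuallyEq ?_
      filter_upwards [Ioi_mem_nhds hgt] with r hr
      exact if_neg (not_le.2 hr)

/-- An arc with `‖x'‖ ≤ C ‖x‖` that vanishes somewhere vanishes identically. -/
lemma ACArc.eq_zero_of_eq_zero (h : ACArc t T x x') {C : ℝ} (hC : 0 ≤ C)
    (hx' : ∀ᵐ s, s ∈ Icc t T → ‖x' s‖ ≤ C * ‖x s‖) {a : ℝ} (ha : a ∈ Icc t T) (hxa : x a = 0) :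
    ∀ s ∈ Icc t T, x s = 0 := by
  have key : ∀ u ∈ Icc t T, ∀ v ∈ Icc t T, u ≤ v →
      ‖x v - x u‖ ≤ C * ∫ r in u..v, ‖x r‖ := fun u hu v hv huv => by
    rw [h.sub_eq_integral hu hv, ← intervalIntegral.integral_const_mul]
    refine intervalIntegral.norm_integral_le_of_norm_le huv ?_ ?_
    · filter_upwards [hx'] with s hs hs'
      exact hs ⟨hu.1.trans hs'.1.le, hs'.2.trans hv.2⟩
    · refine ContinuousOn.intervalIntegrable ((h.continuousOn.norm.const_mul C).mono ?_)
      exact uIcc_subset_Icc hu hv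
  intro s hs
  rw [← norm_le_zero_iff]
  rcases le_total a s with has | hsa
  · have := le_two_mul_exp_of_le_add_integral (f := fun r => ‖x r‖) (A := 0) ha.2
      (h.continuousOn.norm.mono (Icc_subset_Icc_left ha.1)) hC le_rfl
      (fun r hr => by
        have := key a ha r ⟨ha.1.trans hr.1, hr.2⟩ hr.1
        rwa [hxa, sub_zero, ← zero_add (C * _)] at this) s ⟨has, hs.2⟩
    simpa using this
  · have := le_two_mul_exp_of_le_add_integral (f := fun r => ‖x (-r)‖) (A := 0)
      (neg_le_neg ha.1)
      ((h.continuousOn.norm.comp continuousOn_neg fun r hr => ⟨by linarith [hr.2],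
        by linarith [hr.1, ha.2]⟩)) hC le_rfl
      (fun r hr => by
        have := key (-r) ⟨by linarith [hr.2], by linarith [hr.1, ha.2]⟩ a ha (by linarith [hr.1])
        rw [hxa, zero_sub, norm_neg] at this
        rwa [zero_add, intervalIntegral.integral_comp_neg (fun r => ‖x r‖), neg_neg])
      (-s) ⟨neg_le_neg hsa, neg_le_neg hs.1⟩
    simpa using this

/-- A lower bound on the derivative of `⟪p, z⟫` gives a lower bound on its increment. -/
lemma ACArc.inner_sub_inner_ge {p p' z z' : ℝ → E} (htT : t ≤ T) (hp : ACArc t T p p')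
    (hz : ACArc t T z z') {B K : ℝ} (hB : 0 ≤ B) (hpB : ∀ᵐ s, s ∈ Icc t T → ‖p' s‖ ≤ B)
    (hzB : ∀ᵐ s, s ∈ Icc t T → ‖z' s‖ ≤ B)
    (hK : ∀ᵐ s, s ∈ Icc t T → -K ≤ ⟪p' s, z s⟫ + ⟪p s, z' s⟫) :
    ⟪p t, z t⟫ - K * (T - t) ≤ ⟪p T, z T⟫ := by
  obtain ⟨P, hP⟩ := isCompact_Icc.exists_bound_of_continuousOn hp.continuousOn
  obtain ⟨Z, hZ⟩ := isCompact_Icc.exists_bound_of_continuousOn hz.continuousOn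
  have ht : t ∈ Icc t T := ⟨le_rfl, htT⟩
  have hP0 : 0 ≤ P := (norm_nonneg _).trans (hP t ht)
  have hZ0 : 0 ≤ Z := (norm_nonneg _).trans (hZ t ht)
  have hlip : LipschitzOnWith (B * Z + P * B).toNNReal (fun s => ⟪p s, z s⟫) (uIcc t T) := by
    rw [uIcc_of_le htT]
    refine LipschitzOnWith.of_dist_le_mul fun a ha b hb => ?_
    rw [Real.coe_toNNReal _ (by positivity), Real.dist_eq, Real.dist_eq]
    have e : ⟪p a, z a⟫ - ⟪p b, z b⟫ = ⟪p a - p b, z a⟫ + ⟪p b, z a - z b⟫ := by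
      rw [inner_sub_left, inner_sub_right]; ring
    rw [e]
    calc _ ≤ ‖p a - p b‖ * ‖z a‖ + ‖p b‖ * ‖z a - z b‖ :=
          (abs_add_le _ _).trans (add_le_add (abs_real_inner_le_norm _ _)
            (abs_real_inner_le_norm _ _))
      _ ≤ (B * |a - b|) * Z + P * (B * |a - b|) :=
          add_le_add
            (mul_le_mul (hp.norm_sub_le hpB hb ha) (hZ a ha) (norm_nonneg _) (by positivity))
            (mul_le_mul (hP b hb) (hz.norm_sub_le hzB hb ha) (norm_nonneg _) hP0)
      _ = _ := by ring
  have hac := hlip.absolutelyContinuousOnInterval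
  have h1 := hac.integral_deriv_eq_sub
  have h2 : ∫ _ in t..T, -K ≤ ∫ s in t..T, deriv (fun s => ⟪p s, z s⟫) s := by
    refine intervalIntegral.integral_mono_ae_restrict htT (by simp) hac.intervalIntegrable_deriv ?_
    rw [EventuallyLE, ae_restrict_iff' measurableSet_Icc]
    filter_upwards [hK, hp.2.2, hz.2.2] with s hs hps hzs hs'
    rw [((hps hs').inner ℝ (hzs hs')).deriv]
    linarith [hs hs']
  rw [intervalIntegral.integral_const, smul_eq_mul] at h2
  linarith

lemma ACArc.sub {y y' : ℝ → E} (hy : ACArc t T y y') (hx : ACArc t T x x') :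
    ACArc t T (fun s => y s - x s) (fun s => y' s - x' s) := by
  refine ⟨hy.1.sub hx.1, fun s hs => ?_, ?_⟩
  · have ht : t ∈ Icc t T := ⟨le_rfl, hs.1.trans hs.2⟩
    dsimp only
    rw [intervalIntegral.integral_sub (hy.intervalIntegrable ht hs) (hx.intervalIntegrable ht hs),
      hy.2.1 s hs, hx.2.1 s hs]
    abel
  · filter_upwards [hy.2.2, hx.2.2] with s h1 h2 hs using (h1 hs).sub (h2 hs)

end Arcs

/-- The iteration in the proof of Filippov's theorem: `v₀ = P(s, x, x')` and
`vₖ₊₁ = P(s, yₖ, vₖ)`, where `yₖ` is the primitive of `vₖ` with `yₖ(t) = a`. -/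
def trackingSeq (P : ℝ → E → E → E) (t : ℝ) (x x' : ℝ → E) (a : E) : ℕ → ℝ → E
  | 0 => fun s => P s (x s) (x' s)
  | k + 1 => fun s => P s (a + ∫ r in t..s, trackingSeq P t x x' a k r) (trackingSeq P t x x' a k s)

section Tracking

variable {P : ℝ → E → E → E} {L t T : ℝ} {x x' : ℝ → E}

lemma trackingSeq_estimate (hL : 0 ≤ L) (hP : Continuous fun q : ℝ × E × E => P q.1 q.2.1 q.2.2)
    (hlip : ∀ s u z w, ‖P s u (P s z w) - P s z w‖ ≤ L * ‖u - z‖) (htT : t ≤ T)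
    (hx : ACArc t T x x') (hx' : ∀ᵐ s, s ∈ Icc t T → P s (x s) (x' s) = x' s) (a : E) (k : ℕ) :
    IntervalIntegrable (trackingSeq P t x x' a k) volume t T ∧
    ∀ s ∈ Icc t T, ‖trackingSeq P t x x' a (k + 1) s - trackingSeq P t x x' a k s‖ ≤
      L * ‖a - x t‖ * Real.exp (2 * L * (s - t)) / 2 ^ k := by
  set v := trackingSeq P t x x' a
  have ht : t ∈ Icc t T := ⟨le_rfl, htT⟩
  have sub_int : ∀ f : ℝ → E, IntervalIntegrable f volume t T → ∀ s ∈ Icc t T,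
      IntervalIntegrable f volume t s := fun f hf s hs => hf.mono_set (by
    rw [uIcc_of_le htT, uIcc_of_le hs.1]
    exact Icc_subset_Icc_right hs.2)
  induction k with
  | zero =>
    have i0 : IntervalIntegrable (v 0) volume t T := by
      refine hx.1.congr_ae ?_
      rw [EventuallyEq, ae_restrict_iff' measurableSet_uIoc]
      filter_upwards [hx'] with s hs hs'
      rw [uIoc_of_le htT] at hs'
      exact (hs (Ioc_subset_Icc_self hs')).symm
    refine ⟨i0, fun s hs => ?_⟩
    have e : ∫ r in t..s, v 0 r = x s - x t := by
      rw [hx.sub_eq_integral ht hs]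
      refine intervalIntegral.integral_congr_ae ?_
      filter_upwards [hx'] with r hr hr'
      rw [uIoc_of_le hs.1] at hr'
      exact hr ⟨hr'.1.le, hr'.2.trans hs.2⟩
    have h1 := hlip s (a + ∫ r in t..s, v 0 r) (x s) (x' s)
    rw [e, show a + (x s - x t) - x s = a - x t by abel, ← e] at h1
    refine h1.trans ?_
    rw [pow_zero, div_one]
    refine le_mul_of_one_le_right (by positivity) (Real.one_le_exp ?_)
    exact mul_nonneg (by positivity) (sub_nonneg.2 hs.1)
  | succ k ih =>
    obtain ⟨ik, hk⟩ := ih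
    have hmeas : AEStronglyMeasurable (v (k + 1)) (volume.restrict (uIoc t T)) := by
      have h1 : AEStronglyMeasurable (fun s => a + ∫ r in t..s, v k r)
          (volume.restrict (uIoc t T)) := by
        refine ContinuousOn.aestronglyMeasurable ?_ measurableSet_uIoc
        exact (continuousOn_const.add
          (intervalIntegral.continuousOn_primitive_interval' ik left_mem_uIcc)).mono
          uIoc_subset_uIcc
      exact hP.comp_aestronglyMeasurable
        (aestronglyMeasurable_id.prodMk (h1.prodMk ik.aestronglyMeasurable_restrict_uIoc))
    have isub : IntervalIntegrable (fun s => v (k + 1) s - v k s) volume t T := by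
      refine IntervalIntegrable.mono_fun' (g := fun s =>
        L * ‖a - x t‖ * Real.exp (2 * L * (s - t)) / 2 ^ k)
        (Continuous.intervalIntegrable (by fun_prop) _ _)
        (hmeas.sub ik.aestronglyMeasurable_restrict_uIoc) ?_
      rw [EventuallyLE, ae_restrict_iff' measurableSet_uIoc]
      refine ae_of_all _ fun s hs => hk s ?_
      rw [uIoc_of_le htT] at hs
      exact Ioc_subset_Icc_self hs
    have ik1 : IntervalIntegrable (v (k + 1)) volume t T := by
      simpa using isub.add ik
    refine ⟨ik1, fun s hs => ?_⟩
    have h1 := hlip s (a + ∫ r in t..s, v (k + 1) r) (a + ∫ r in t..s, v k r) (v k s)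
    rw [add_sub_add_left_eq_sub,
      ← intervalIntegral.integral_sub (sub_int _ ik1 s hs) (sub_int _ ik s hs)] at h1
    refine h1.trans ?_
    have h2 : ‖∫ r in t..s, (v (k + 1) r - v k r)‖ ≤
        ∫ r in t..s, ‖a - x t‖ / 2 ^ k * (L * Real.exp (2 * L * (r - t))) := by
      refine intervalIntegral.norm_integral_le_of_norm_le hs.1 (ae_of_all _ fun r hr => ?_)
        (Continuous.intervalIntegrable (by fun_prop) _ _)
      refine (hk r ⟨hr.1.le, hr.2.trans hs.2⟩).trans_eq ?_
      ring
    rw [intervalIntegral.integral_const_mul, integral_mul_exp_sub] at h2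
    calc _ ≤ L * (‖a - x t‖ / 2 ^ k * ((Real.exp (2 * L * (s - t)) - 1) / 2)) :=
          mul_le_mul_of_nonneg_left h2 hL
      _ ≤ L * (‖a - x t‖ / 2 ^ k * (Real.exp (2 * L * (s - t)) / 2)) := by
          gcongr
          linarith
      _ = _ := by
          rw [pow_succ]
          field_simp

/-- A Filippov-type theorem. Let `P s u` be a continuous family of retractions onto sets that
depend on `u` in a Lipschitz way. Given an arc `x` with `P s (x s) (x' s) = x' s` and a starting
point `a`, there is an arc `y` with the same property that starts from `a` and stays within
a constant multiple of `‖a - x t‖` of `x`. -/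
theorem exists_tracking_arc (hL : 0 ≤ L)
    (hP : Continuous fun q : ℝ × E × E => P q.1 q.2.1 q.2.2)
    (hlip : ∀ s u z w, ‖P s u (P s z w) - P s z w‖ ≤ L * ‖u - z‖) (htT : t ≤ T)
    (hx : ACArc t T x x') (hx' : ∀ᵐ s, s ∈ Icc t T → P s (x s) (x' s) = x' s) (a : E) :
    ∃ y v : ℝ → E, ACArc t T y v ∧ y t = a ∧ (∀ s ∈ Icc t T, P s (y s) (v s) = v s) ∧
      ∀ s ∈ Icc t T, ‖y s - x s‖ ≤
        (1 + 2 * L * Real.exp (2 * L * (T - t)) * (T - t)) * ‖a - x t‖ := by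
  have est := trackingSeq_estimate hL hP hlip htT hx hx' a
  have hsucc : ∀ k s, trackingSeq P t x x' a (k + 1) s =
    P s (a + ∫ r in t..s, trackingSeq P t x x' a k r) (trackingSeq P t x x' a k s) :=
      fun _ _ => rfl
  have hzero : ∀ s, trackingSeq P t x x' a 0 s = P s (x s) (x' s) := fun _ => rfl
  set v := trackingSeq P t x x' a
  have ht : t ∈ Icc t T := ⟨le_rfl, htT⟩
  have sub_int : ∀ f : ℝ → E, IntervalIntegrable f volume t T → ∀ s ∈ Icc t T,
      IntervalIntegrable f volume t s := fun f hf s hs => hf.mono_set (by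
    rw [uIcc_of_le htT, uIcc_of_le hs.1]
    exact Icc_subset_Icc_right hs.2)
  set C := 2 * (L * ‖a - x t‖ * Real.exp (2 * L * (T - t))) with hC
  have hC0 : 0 ≤ C := by positivity
  have hdist : ∀ s ∈ Icc t T, ∀ k, dist (v k s) (v (k + 1) s) ≤ C / 2 / 2 ^ k := fun s hs k => by
    rw [dist_comm, dist_eq_norm]
    refine ((est k).2 s hs).trans ?_
    rw [hC, mul_div_cancel_left₀ _ two_ne_zero]
    gcongr
    exact hs.2
  have hlim : ∀ s, ∃ l, s ∈ Icc t T → Tendsto (fun k => v k s) atTop (𝓝 l) := fun s => by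
    by_cases hs : s ∈ Icc t T
    · obtain ⟨l, hl⟩ := cauchySeq_tendsto_of_complete (cauchySeq_of_le_geometric_two (hdist s hs))
      exact ⟨l, fun _ => hl⟩
    · exact ⟨0, fun h => absurd h hs⟩
  choose w hw using hlim
  have hvw : ∀ s ∈ Icc t T, ∀ k, ‖w s - v k s‖ ≤ C / 2 ^ k := fun s hs k => by
    rw [← dist_eq_norm, dist_comm]
    exact dist_le_of_le_geometric_two_of_tendsto (hdist s hs) (hw s hs) k
  have hw0 : ∀ s ∈ Icc t T, ‖w s - v 0 s‖ ≤ C := fun s hs => by simpa using hvw s hs 0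
  have hmeas : AEStronglyMeasurable w (volume.restrict (uIoc t T)) := by
    refine aestronglyMeasurable_of_tendsto_ae atTop
      (fun k => (est k).1.aestronglyMeasurable_restrict_uIoc) ?_
    rw [ae_restrict_iff' measurableSet_uIoc]
    refine ae_of_all _ fun s hs => hw s ?_
    rw [uIoc_of_le htT] at hs
    exact Ioc_subset_Icc_self hs
  have isub : IntervalIntegrable (fun s => w s - v 0 s) volume t T := by
    refine IntervalIntegrable.mono_fun' (g := fun _ => C) (by simp)
      (hmeas.sub (est 0).1.aestronglyMeasurable_restrict_uIoc) ?_
    rw [EventuallyLE, ae_restrict_iff' measurableSet_uIoc]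
    refine ae_of_all _ fun s hs => hw0 s ?_
    rw [uIoc_of_le htT] at hs
    exact Ioc_subset_Icc_self hs
  have iw : IntervalIntegrable w volume t T := by simpa using isub.add (est 0).1
  have hdiff : ∀ s ∈ Icc t T, ∀ k, ‖(∫ r in t..s, w r) - ∫ r in t..s, v k r‖ ≤
      C / 2 ^ k * (T - t) := fun s hs k => by
    rw [← intervalIntegral.integral_sub (sub_int _ iw s hs) (sub_int _ (est k).1 s hs)]
    calc _ ≤ C / 2 ^ k * |s - t| := by
          refine intervalIntegral.norm_integral_le_of_norm_le_const fun r hr => ?_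
          rw [uIoc_of_le hs.1] at hr
          exact hvw r ⟨hr.1.le, hr.2.trans hs.2⟩ k
      _ ≤ _ := by
          rw [abs_of_nonneg (sub_nonneg.2 hs.1)]
          gcongr
          exact hs.2
  have hpow : Tendsto (fun k : ℕ => C / 2 ^ k) atTop (𝓝 0) :=
    tendsto_const_nhds.div_atTop (tendsto_pow_atTop_atTop_of_one_lt one_lt_two)
  refine ⟨fun s => a + ∫ r in t..s, w r, w, ACArc.of_integral htT a iw, by simp, fun s hs => ?_,
    fun s hs => ?_⟩
  · have h1 : ∀ k, ‖P s (a + ∫ r in t..s, w r) (v (k + 1) s) - v (k + 1) s‖ ≤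
        L * (C / 2 ^ k * (T - t)) := fun k => by
      rw [hsucc]
      refine (hlip s _ _ _).trans (mul_le_mul_of_nonneg_left ?_ hL)
      rw [add_sub_add_left_eq_sub]
      exact hdiff s hs k
    have h2 : Tendsto (fun k => v (k + 1) s) atTop (𝓝 (w s)) :=
      (hw s hs).comp (tendsto_add_atTop_nat 1)
    have h3 : Continuous fun z => P s (a + ∫ r in t..s, w r) z :=
      hP.comp (continuous_const.prodMk (continuous_const.prodMk continuous_id))
    have h4 := (((h3.tendsto _).comp h2).sub h2).norm
    have h5 : Tendsto (fun k : ℕ => L * (C / 2 ^ k * (T - t))) atTop (𝓝 0) := by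
      simpa using (hpow.mul_const (T - t)).const_mul L
    exact sub_eq_zero.1 (norm_le_zero_iff.1 (le_of_tendsto_of_tendsto' h4 h5 h1))
  · have e : ∫ r in t..s, v 0 r = x s - x t := by
      rw [hx.sub_eq_integral ht hs]
      refine intervalIntegral.integral_congr_ae ?_
      filter_upwards [hx'] with r hr hr'
      rw [uIoc_of_le hs.1] at hr'
      rw [hzero]
      exact hr ⟨hr'.1.le, hr'.2.trans hs.2⟩
    have h1 := hdiff s hs 0
    rw [e, pow_zero, div_one] at h1
    calc ‖a + (∫ r in t..s, w r) - x s‖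
        = ‖(a - x t) + ((∫ r in t..s, w r) - (x s - x t))‖ := by congr 1; abel
      _ ≤ ‖a - x t‖ + C * (T - t) := (norm_add_le _ _).trans (by gcongr)
      _ = _ := by rw [hC]; ring

end Tracking

section Hamiltonian

variable {F : E → Set E} {x p : E}

lemma inner_le_ham (hF : IsCompact (F x)) {v : E} (hv : v ∈ F x) (p : E) :
    ⟪v, p⟫ ≤ Ham F x p :=
  le_csSup (hF.image (by fun_prop)).bddAbove (mem_image_of_mem _ hv)

lemma exists_inner_eq_ham (hne : (F x).Nonempty) (hF : IsCompact (F x)) (p : E) :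
    ∃ v ∈ F x, ⟪v, p⟫ = Ham F x p :=
  (hF.image (f := fun v => ⟪v, p⟫) (by fun_prop)).sSup_mem (hne.image _)

lemma ham_zero_right (hne : (F x).Nonempty) (hF : IsCompact (F x)) : Ham F x 0 = 0 := by
  obtain ⟨v, -, hv⟩ := exists_inner_eq_ham hne hF 0
  rw [← hv, inner_zero_right]

lemma continuous_ham (hne : (F x).Nonempty) (hF : IsCompact (F x)) :
    Continuous fun p => Ham F x p := by
  obtain ⟨M, hM⟩ := hF.exists_bound_of_continuousOn (f := id) continuousOn_id
  have hM0 : 0 ≤ M := (norm_nonneg _).trans (hM _ hne.some_mem)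
  have key : ∀ p q, Ham F x p ≤ Ham F x q + M * dist p q := fun p q => by
    obtain ⟨v, hv, e⟩ := exists_inner_eq_ham hne hF p
    have h1 := inner_le_ham hF hv q
    have h2 : ⟪v, p - q⟫ ≤ M * ‖p - q‖ :=
      (real_inner_le_norm _ _).trans (mul_le_mul_of_nonneg_right (hM v hv) (norm_nonneg _))
    rw [inner_sub_right] at h2
    rw [dist_eq_norm]
    linarith
  exact (LipschitzWith.of_le_add_mul ⟨M, hM0⟩ key).continuous

lemma ham_sub_ham_le {K : Set E} {L : ℝ} (hL : SetLipOn F K L)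
    (hval : ∀ x, (F x).Nonempty ∧ Convex ℝ (F x) ∧ IsCompact (F x)) {y : E} (hx : x ∈ K)
    (hy : y ∈ K) (p : E) : Ham F x p - Ham F y p ≤ L * ‖p‖ * ‖x - y‖ := by
  obtain ⟨v, hv, e⟩ := exists_inner_eq_ham (hval x).1 (hval x).2.2 p
  obtain ⟨w, hw, hvw⟩ := hL x hx y hy v hv
  have h1 := inner_le_ham (hval y).2.2 hw p
  have h2 : ⟪v - w, p⟫ ≤ L * ‖x - y‖ * ‖p‖ :=
    (real_inner_le_norm _ _).trans (mul_le_mul_of_nonneg_right hvw (norm_nonneg _))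
  rw [inner_sub_left] at h2
  linarith

lemma ham_div_le (hne : (F x).Nonempty) (hF : IsCompact (F x)) (p q : E) {h : ℝ} (h0 : 0 < h)
    (h1 : h ≤ 1) : (Ham F x (q + h • -p) - Ham F x q) / h ≤ Ham F x (q - p) - Ham F x q := by
  obtain ⟨v, hv, e⟩ := exists_inner_eq_ham hne hF (q + h • -p)
  have e1 := inner_le_ham hF hv q
  have e2 := inner_le_ham hF hv (q - p)
  rw [div_le_iff₀ h0, ← e]
  rw [inner_sub_right] at e2
  rw [inner_add_right, inner_smul_right, inner_neg_right]
  nlinarith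

lemma inner_eq_ham_of_mem_clarkeGrad (hne : (F x).Nonempty) (hF : IsCompact (F x)) {v : E}
    (hv : v ∈ F x) (hv' : v ∈ ClarkeGrad (fun q => Ham F x q) p) : ⟪v, p⟫ = Ham F x p := by
  refine le_antisymm (inner_le_ham hF hv p) (le_of_forall_pos_le_add fun ε hε => ?_)
  have hlim : Tendsto (fun q => Ham F x (q - p) - Ham F x q) (𝓝 p) (𝓝 (-Ham F x p)) :=
    Continuous.tendsto' (((continuous_ham hne hF).comp (continuous_id.sub continuous_const)).sub
      (continuous_ham hne hF)) _ _ (by simp [ham_zero_right hne hF])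
  have ev1 : ∀ᶠ q : E × ℝ in 𝓝 p ×ˢ 𝓝[>] (0 : ℝ),
      Ham F x (q.1 - p) - Ham F x q.1 < -Ham F x p + ε / 2 :=
    tendsto_fst.eventually (hlim.eventually_lt_const (by linarith))
  have ev2 : ∀ᶠ q : E × ℝ in 𝓝 p ×ˢ 𝓝[>] (0 : ℝ), q.2 ∈ Ioc (0 : ℝ) 1 :=
    tendsto_snd.eventually (Ioc_mem_nhdsGT one_pos)
  obtain ⟨q, hq, hq1, hq2⟩ := ((hv' (-p) (ε / 2) (by positivity)).and_eventually
    (ev1.and ev2)).exists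
  have := ham_div_le hne hF p q.1 hq2.1 hq2.2
  rw [inner_neg_right] at hq
  linarith

lemma eq_of_inner_eq_ham (hF : IsCompact (F x)) {g v : E}
    (hg : HasGradientAt (fun q => Ham F x q) g p) (hv : v ∈ F x) (hvp : ⟪v, p⟫ = Ham F x p) :
    v = g := by
  have hd := hg.hasFDerivAt.sub (innerSL ℝ v).hasFDerivAt
  have hmin : IsLocalMin ((fun q => Ham F x q) - ⇑(innerSL ℝ v)) p := by
    refine Eventually.of_forall fun q => ?_
    simp only [Pi.sub_apply, innerSL_apply_apply, hvp, sub_self]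
    exact sub_nonneg.2 (inner_le_ham hF hv q)
  have h0 := congrArg (fun T => T (g - v)) (hmin.hasFDerivAt_eq_zero hd)
  simp only [sub_apply, InnerProductSpace.toDual_apply_apply,
    innerSL_apply_apply, zero_apply, ← inner_sub_left, inner_self_eq_zero] at h0
  exact (sub_eq_zero.1 h0).symm

lemma gradpH_spec (hH : HypH1 F) (hne : (F x).Nonempty) (hF : IsCompact (F x)) (hp : p ≠ 0) :
    gradpH F x p ∈ F x ∧ ⟪gradpH F x p, p⟫ = Ham F x p := by
  obtain ⟨v, hv, e⟩ := exists_inner_eq_ham hne hF p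
  rw [← eq_of_inner_eq_ham hF (hH.2.1 x p hp) hv e]
  exact ⟨hv, e⟩

lemma continuousAt_gradpH (hH : HypH1 F) (hne : (F x).Nonempty) (hF : IsCompact (F x))
    (hp : p ≠ 0) : ContinuousAt (fun q => gradpH F x q) p := by
  have ev : ∀ᶠ q in 𝓝 p, q ≠ 0 := isOpen_ne.mem_nhds hp
  refine hF.tendsto_nhds_of_unique_mapClusterPt
    (ev.mono fun q hq => (gradpH_spec hH hne hF hq).1) fun y hy hcl => ?_
  refine eq_of_inner_eq_ham hF (hH.2.1 x p hp) hy ?_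
  obtain ⟨M, hM⟩ := hF.exists_bound_of_continuousOn (f := id) continuousOn_id
  have hlim : Tendsto (fun q => ⟪gradpH F x q, p⟫) (𝓝 p) (𝓝 (Ham F x p)) := by
    have h1 : Tendsto (fun q => Ham F x q + ⟪gradpH F x q, p - q⟫) (𝓝 p) (𝓝 (Ham F x p + 0)) := by
      refine ((continuous_ham hne hF).tendsto p).add ?_
      refine squeeze_zero_norm' (a := fun q => M * ‖p - q‖) (ev.mono fun q hq => ?_) ?_
      · exact (norm_inner_le_norm _ _).trans
          (mul_le_mul_of_nonneg_right (hM _ (gradpH_spec hH hne hF hq).1) (norm_nonneg _))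
      · exact Continuous.tendsto' (by fun_prop) _ _ (by simp)
    rw [add_zero] at h1
    refine h1.congr' (ev.mono fun q hq => ?_)
    rw [inner_sub_right, (gradpH_spec hH hne hF hq).2]
    ring
  have hcl' : MapClusterPt ⟪y, p⟫ (𝓝 p) fun q => ⟪gradpH F x q, p⟫ :=
    hcl.tendsto_comp (Continuous.tendsto (f := fun z : E => ⟪z, p⟫) (by fun_prop) y)
  have : (𝓝 ⟪y, p⟫ ⊓ 𝓝 (Ham F x p)).NeBot := ClusterPt.mono hcl' hlim
  exact eq_of_nhds_neBot this

end Hamiltonian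

lemma norm_le_of_mem_fSub {f : E → ℝ} {x q : E} {M : ℝ} (hM : 0 ≤ M)
    (hf : ∀ᶠ y in 𝓝 x, f y - f x ≤ M * ‖y - x‖) (hq : q ∈ FSub f x) : ‖q‖ ≤ M := by
  refine le_of_forall_pos_le_add fun ε hε => ?_
  rcases eq_or_ne q 0 with rfl | hq0
  · rw [norm_zero]; positivity
  have hlim : Tendsto (fun s : ℝ => x + s • q) (𝓝[>] 0) (𝓝 x) :=
    (Continuous.tendsto' (by fun_prop) _ _ (by simp)).mono_left nhdsWithin_le_nhds
  obtain ⟨s, ⟨h1, h2⟩, hs⟩ := ((hlim.eventually (hf.and (hq ε hε))).and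
    self_mem_nhdsWithin).exists
  have hs : 0 < s := hs
  rw [add_sub_cancel_left, norm_smul, Real.norm_of_nonneg hs.le] at h1 h2
  rw [inner_smul_right, real_inner_self_eq_norm_sq] at h2
  have hpos : 0 < s * ‖q‖ := mul_pos hs (norm_pos_iff.2 hq0)
  refine le_of_mul_le_mul_left ?_ hpos
  nlinarith

lemma SemiconvexWith.sub_sub_inner_ge {f : E → ℝ} {K : Set E} {c : ℝ} (hf : SemiconvexWith f K c)
    (hK : Convex ℝ K) (hc : 0 ≤ c) {x h q : E} (hx : x ∈ K) (hxh : x + h ∈ K)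
    (hq : q ∈ FSub f x) : -(c * ‖h‖ ^ 2) ≤ f (x + h) - f x - ⟪q, h⟫ := by
  set a : ℝ → ℝ := fun u => f (x + u • h) - f x - u * ⟪q, h⟫ with ha
  have hmem : ∀ u : ℝ, 0 ≤ u → u ≤ 1 → x + u • h ∈ K := fun u h0 h1 => by
    have := hK hx hxh (sub_nonneg.2 h1) h0 (by ring)
    convert this using 1
    rw [sub_smul, one_smul, smul_add]
    abel
  have step : ∀ u : ℝ, 0 ≤ u → u ≤ 1 → 2 * a (u / 2) ≤ a u + c * (u / 2) ^ 2 * ‖h‖ ^ 2 :=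
    fun u h0 h1 => by
    have e1 : x + (u / 2) • h + (u / 2) • h = x + u • h := by
      rw [add_assoc, ← add_smul, add_halves]
    have e2 : x + (u / 2) • h - (u / 2) • h = x := add_sub_cancel_right _ _
    have := hf (x + (u / 2) • h) ((u / 2) • h) (by rw [e1]; exact hmem u h0 h1) (by rwa [e2])
    rw [e1, e2, norm_smul, mul_pow, Real.norm_eq_abs, sq_abs] at this
    simp only [ha]
    linarith
  have ind : ∀ k : ℕ, a ((1 / 2) ^ k) ≤
      (1 / 2) ^ k * a 1 + c / 2 * ‖h‖ ^ 2 * ((1 - (1 / 2) ^ k) * (1 / 2) ^ k) := fun k => by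
    induction k with
    | zero => simp
    | succ k ih =>
      have := step ((1 / 2) ^ k) (by positivity) (pow_le_one₀ (by norm_num) (by norm_num))
      rw [pow_succ, mul_one_div]
      linarith
  have hlim : Tendsto (fun k : ℕ => x + ((1 / 2 : ℝ) ^ k) • h) atTop (𝓝 x) := by
    have := ((tendsto_pow_atTop_nhds_zero_of_lt_one (by norm_num : (0 : ℝ) ≤ 1 / 2)
      (by norm_num)).smul_const h).const_add x
    simpa using this
  have hmain : ∀ ε > 0, -(c * ‖h‖ ^ 2) ≤ a 1 + ε * ‖h‖ := fun ε hε => by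
    obtain ⟨k, hk⟩ := (hlim.eventually (hq ε hε)).exists
    have hu : (0 : ℝ) < (1 / 2) ^ k := by positivity
    have hu1 : (1 / 2 : ℝ) ^ k ≤ 1 := pow_le_one₀ (by norm_num) (by norm_num)
    have hi := ind k
    rw [add_sub_cancel_left, norm_smul, Real.norm_of_nonneg hu.le, inner_smul_right] at hk
    set u : ℝ := (1 / 2) ^ k
    have h3 : -(ε * (u * ‖h‖)) ≤ a u := hk
    have hcN : 0 ≤ c * ‖h‖ ^ 2 := by positivity
    refine le_of_mul_le_mul_left ?_ hu
    nlinarith [mul_nonneg hcN hu.le, mul_nonneg (mul_nonneg hcN hu.le) hu.le]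
  have h1 : a 1 = f (x + h) - f x - ⟪q, h⟫ := by simp [ha]
  rw [← h1]
  refine le_of_forall_pos_le_add fun ε hε => (hmain (ε / (‖h‖ + 1)) (by positivity)).trans ?_
  gcongr
  rw [div_mul_eq_mul_div, div_le_iff₀ (by positivity)]
  nlinarith [norm_nonneg h]

section Value

variable {F : E → Set E} {φ : E → ℝ} {t T : ℝ}

lemma IsTraj.norm_le {y y' : ℝ → E} {r : ℝ} (hr : 0 ≤ r)
    (hF : ∀ x : E, ∀ v ∈ F x, ‖v‖ ≤ r * (1 + ‖x‖)) (hy : IsTraj F t T y y') :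
    ∀ s ∈ Icc t T, ‖y s‖ ≤ 2 * (1 + ‖y t‖) * Real.exp (2 * r * (s - t)) := by
  intro s hs
  have htT : t ≤ T := hs.1.trans hs.2
  have hcont : ContinuousOn (fun s => 1 + ‖y s‖) (Icc t T) :=
    continuousOn_const.add hy.1.continuousOn.norm
  have key := le_two_mul_exp_of_le_add_integral (A := 1 + ‖y t‖) htT hcont hr (by positivity)
    (fun s hs => ?_) s hs
  · linarith
  · have h1 : ‖∫ q in t..s, y' q‖ ≤ ∫ q in t..s, r * (1 + ‖y q‖) := by
      refine intervalIntegral.norm_integral_le_of_norm_le hs.1 ?_ ?_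
      · filter_upwards [hy.2] with q hq hqs
        exact hF _ _ (hq ⟨hqs.1.le, hqs.2.trans hs.2⟩)
      · refine ContinuousOn.intervalIntegrable ?_
        rw [uIcc_of_le hs.1]
        exact continuousOn_const.mul (hcont.mono (Icc_subset_Icc_right hs.2))
    rw [intervalIntegral.integral_const_mul] at h1
    have h2 := norm_add_le (y t) (∫ q in t..s, y' q)
    rw [← hy.1.2.1 s hs] at h2
    linarith

lemma valueFn_le [ProperSpace E] (hF : StandingHyp F) (hφ : Continuous φ) {y y' : ℝ → E}
    (htT : t ≤ T) (hy : IsTraj F t T y y') : valueFn F φ T t (y t) ≤ φ (y T) := by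
  obtain ⟨-, -, r, hr, hgr⟩ := hF
  refine csInf_le ?_ ⟨y, y', hy, rfl, rfl⟩
  obtain ⟨m, hm⟩ := ((isCompact_closedBall (0 : E)
    (2 * (1 + ‖y t‖) * Real.exp (2 * r * (T - t)))).image hφ).bddBelow
  refine ⟨m, ?_⟩
  rintro _ ⟨z, z', hz, hzt, rfl⟩
  refine hm (mem_image_of_mem _ ?_)
  rw [mem_closedBall_zero_iff, ← hzt]
  exact hz.norm_le hr.le hgr T ⟨htT, le_rfl⟩

lemma IsOptimal.le_valueFn {t₀ : ℝ} {x₀ : E} {x x' : ℝ → E}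
    (hx : IsOptimal F φ t₀ T x₀ x x') (ht : t ∈ Icc t₀ T) :
    φ (x T) ≤ valueFn F φ T t (x t) := by
  obtain ⟨⟨hx1, hx2⟩, hx0, hmin⟩ := hx
  refine le_csInf ⟨φ (x T), x, x', ⟨hx1.restrict ht, ?_⟩, rfl, rfl⟩ ?_
  · filter_upwards [hx2] with s hs hst
    exact hs ⟨ht.1.trans hst.1, hst.2⟩
  rintro _ ⟨y, y', hy, hyt, rfl⟩
  have h := hmin _ _ ⟨hx1.concat ht hy.1 hyt, ?_⟩ (by simp [ht.1, hx0])
  · refine h.trans_eq ?_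
    rcases ht.2.eq_or_lt with rfl | hlt
    · simp [hyt]
    · simp [hlt.not_ge]
  · filter_upwards [hx2, hy.2] with s h1 h2 hs
    by_cases hst : s ≤ t
    · simpa [hst] using h1 hs
    · simpa [hst] using h2 ⟨(not_le.1 hst).le, hs.2⟩

end Value

lemma SetLipOn.norm_le_of_mem_fSub {F : E → Set E} {K : Set E} {L : ℝ} (hF : SetLipOn F K L)
    (hL : 0 ≤ L) (hval : ∀ x, (F x).Nonempty ∧ Convex ℝ (F x) ∧ IsCompact (F x)) {x p q : E}
    (hK : K ∈ 𝓝 x) (hq : q ∈ FSub (fun y => Ham F y p) x) : ‖q‖ ≤ L * ‖p‖ :=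
  _root_.norm_le_of_mem_fSub (by positivity)
    (mem_of_superset hK fun _ hy => ham_sub_ham_le hF hval hy (mem_of_mem_nhds hK) p) hq

section Neighbouring

variable {F : E → Set E} {t₀ T : ℝ} {x x' p p' : ℝ → E}

/-- If the maximizers of `⟪·, p s⟫` over `F y` are the fixed points of a continuous family of
retractions depending on `y` in a Lipschitz way, then any arc made of maximizers can be followed
by arcs of the same kind starting from nearby points. -/
lemma exists_traj_near_of_retraction {P : ℝ → E → E → E} {L : ℝ} (hL : 0 ≤ L)
    (hP : Continuous fun q : ℝ × E × E => P q.1 q.2.1 q.2.2)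
    (hlip : ∀ s u z w, ‖P s u (P s z w) - P s z w‖ ≤ L * ‖u - z‖) (htT : t₀ ≤ T)
    (hx : ACArc t₀ T x x') (hx' : ∀ᵐ s, s ∈ Icc t₀ T → P s (x s) (x' s) = x' s)
    (hfix : ∀ s ∈ Icc t₀ T, ∀ y, ‖y - x s‖ ≤ 1 → ∀ v, P s y v = v →
      v ∈ F y ∧ ⟪v, p s⟫ = Ham F y (p s)) :
    ∃ C > 0, ∀ t ∈ Icc t₀ T, ∀ h : E, C * ‖h‖ ≤ 1 → ∃ y v : ℝ → E, IsTraj F t T y v ∧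
      y t = x t + h ∧ ∀ s ∈ Icc t T, ‖y s - x s‖ ≤ C * ‖h‖ ∧ ⟪v s, p s⟫ = Ham F (y s) (p s) := by
  have hD : 0 ≤ T - t₀ := sub_nonneg.2 htT
  refine ⟨1 + 2 * L * Real.exp (2 * L * (T - t₀)) * (T - t₀), by positivity, fun t ht h hh => ?_⟩
  obtain ⟨y, v, hy, hyt, hyv, hyx⟩ := exists_tracking_arc hL hP hlip ht.2 (hx.restrict ht)
    (hx'.mono fun s hs hst => hs ⟨ht.1.trans hst.1, hst.2⟩) (x t + h)
  have hyx' : ∀ s ∈ Icc t T, ‖y s - x s‖ ≤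
      (1 + 2 * L * Real.exp (2 * L * (T - t₀)) * (T - t₀)) * ‖h‖ := fun s hs => by
    have h1 := hyx s hs
    rw [add_sub_cancel_left] at h1
    refine h1.trans ?_
    have h2 : 0 ≤ T - t := sub_nonneg.2 ht.2
    have h3 := ht.1
    gcongr
  have hmax : ∀ s ∈ Icc t T, v s ∈ F (y s) ∧ ⟪v s, p s⟫ = Ham F (y s) (p s) := fun s hs =>
    hfix s ⟨ht.1.trans hs.1, hs.2⟩ (y s) ((hyx' s hs).trans hh) (v s) (hyv s hs)
  exact ⟨y, v, ⟨hy, ae_of_all _ fun s hs => (hmax s hs).1⟩, hyt,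
    fun s hs => ⟨hyx' s hs, (hmax s hs).2⟩⟩

/-- Lipschitz dependence on the starting point of arcs along which the velocity maximizes
`⟪·, p s⟫`. -/
lemma exists_traj_near [ProperSpace E] (hF : StandingHyp F) (hH : HypH1 F) (htT : t₀ ≤ T)
    (hx : IsTraj F t₀ T x x') (hp : ContinuousOn p (Icc t₀ T))
    (hp0 : (∀ s ∈ Icc t₀ T, p s = 0) ∨ ∀ s ∈ Icc t₀ T, p s ≠ 0)
    (hmax : ∀ᵐ s, s ∈ Icc t₀ T → ⟪x' s, p s⟫ = Ham F (x s) (p s)) :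
    ∃ C > 0, ∀ t ∈ Icc t₀ T, ∀ h : E, C * ‖h‖ ≤ 1 → ∃ y v : ℝ → E, IsTraj F t T y v ∧
      y t = x t + h ∧ ∀ s ∈ Icc t T, ‖y s - x s‖ ≤ C * ‖h‖ ∧ ⟪v s, p s⟫ = Ham F (y s) (p s) := by
  have hval := hF.1
  obtain ⟨R₀, hR₀⟩ := isCompact_Icc.exists_bound_of_continuousOn hx.1.continuousOn
  have hR₀0 : 0 ≤ R₀ := (norm_nonneg _).trans (hR₀ t₀ ⟨le_rfl, htT⟩)
  set K : Set E := closedBall 0 (R₀ + 1) with hKdef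
  have hKne : K.Nonempty := ⟨0, by simp [hKdef]; positivity⟩
  have hKconv : Convex ℝ K := convex_closedBall _ _
  have hKcomp : IsCompact K := isCompact_closedBall _ _
  have hnear : ∀ s ∈ Icc t₀ T, ∀ y, ‖y - x s‖ ≤ 1 → y ∈ K := fun s hs y hy => by
    rw [hKdef, mem_closedBall_zero_iff]
    have := norm_add_le (x s) (y - x s)
    rw [add_sub_cancel] at this
    linarith [hR₀ s hs]
  have hπK : ∀ y, nearestPt K y ∈ K := fun y => (nearestPt_spec hKne hKconv hKcomp y).1
  have hπ : ∀ y ∈ K, nearestPt K y = y := fun y hy => nearestPt_of_mem hKne hKconv hKcomp hy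
  have hπlip := norm_nearestPt_sub_nearestPt_le hKne hKconv hKcomp
  have hxK : ∀ s ∈ Icc t₀ T, x s ∈ K := fun s hs => hnear s hs _ (by simp)
  rcases hp0 with hp0 | hp0
  · obtain ⟨L, hL, hFL⟩ := hF.exists_setLipOn hKcomp
    have hG : SetLipOn (fun y => F (nearestPt K y)) univ L := fun y _ z _ v hv => by
      obtain ⟨w, hw, hvw⟩ := hFL _ (hπK y) _ (hπK z) v hv
      exact ⟨w, hw, hvw.trans (mul_le_mul_of_nonneg_left (hπlip y z) hL)⟩
    have hGval := fun y => hval (nearestPt K y)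
    refine exists_traj_near_of_retraction (P := fun _ y v => nearestPt (F (nearestPt K y)) v) hL
      ((hG.continuous_nearestPt hGval).comp continuous_snd) (fun s u z w => ?_) htT hx.1 ?_ ?_
    · obtain ⟨a1, a2, a3⟩ := hGval z
      obtain ⟨b1, b2, b3⟩ := hGval u
      obtain ⟨q, hq, hzq⟩ := hG z trivial u trivial _ (nearestPt_spec a1 a2 a3 w).1
      rw [norm_sub_rev, norm_sub_rev u]
      exact (norm_sub_nearestPt_le b1 b2 b3 _ hq).trans hzq
    · filter_upwards [hx.2] with s hs hst
      obtain ⟨a1, a2, a3⟩ := hval (x s)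
      rw [hπ _ (hxK s hst)]
      exact nearestPt_of_mem a1 a2 a3 (hs hst)
    · intro s hs y hy v hv
      obtain ⟨a1, a2, a3⟩ := hval y
      rw [hπ y (hnear s hs y hy)] at hv
      refine ⟨hv ▸ (nearestPt_spec a1 a2 a3 v).1, ?_⟩
      rw [hp0 s hs, inner_zero_right, ham_zero_right a1 a3]
  · obtain ⟨L, hL⟩ := hH.2.2 K hKne hKconv hKcomp (p '' Icc t₀ T)
      (isCompact_Icc.image_of_continuousOn hp) (by rintro ⟨s, hs, h0⟩; exact hp0 s hs h0)
    have hproj : ∀ s, (projIcc t₀ T htT s : ℝ) ∈ Icc t₀ T := fun s => (projIcc t₀ T htT s).2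
    have hpc : Continuous fun s => p (projIcc t₀ T htT s) :=
      (continuousOn_iff_continuous_domRestrict.1 hp).comp continuous_projIcc
    have hlip : ∀ s y z, ‖gradpH F (nearestPt K y) (p (projIcc t₀ T htT s)) -
        gradpH F (nearestPt K z) (p (projIcc t₀ T htT s))‖ ≤ L * ‖y - z‖ := fun s y z => by
      have := (hL _ (mem_image_of_mem p (hproj s))).dist_le_mul _ (hπK y) _ (hπK z)
      rw [dist_eq_norm, dist_eq_norm] at this
      exact this.trans (mul_le_mul_of_nonneg_left (hπlip y z) L.2)
    have hcont : Continuous fun q : ℝ × E =>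
        gradpH F (nearestPt K q.2) (p (projIcc t₀ T htT q.1)) := by
      refine continuous_prod_of_continuous_lipschitzWith' _ L (fun s => ?_) fun y => ?_
      · refine LipschitzWith.of_dist_le_mul fun y z => ?_
        simpa [dist_eq_norm] using hlip s y z
      · refine continuous_iff_continuousAt.2 fun s => ?_
        obtain ⟨a1, -, a3⟩ := hval (nearestPt K y)
        exact ContinuousAt.comp (f := fun s => p (projIcc t₀ T htT s))
          (continuousAt_gradpH hH a1 a3 (hp0 _ (hproj s))) hpc.continuousAt
    refine exists_traj_near_of_retraction (L := L)
      (P := fun s y _ => gradpH F (nearestPt K y) (p (projIcc t₀ T htT s))) L.2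
      (hcont.comp (continuous_fst.prodMk (continuous_fst.comp continuous_snd)))
      (fun s u z _ => hlip s u z) htT hx.1 ?_ ?_
    · filter_upwards [hx.2, hmax] with s h1 h2 hs
      rw [hπ _ (hxK s hs), projIcc_of_mem htT hs]
      exact (eq_of_inner_eq_ham (hval _).2.2 (hH.2.1 _ _ (hp0 s hs)) (h1 hs) (h2 hs)).symm
    · intro s hs y hy v hv
      rw [hπ y (hnear s hs y hy), projIcc_of_mem htT hs] at hv
      rw [← hv]
      exact gradpH_spec hH (hval y).1 (hval y).2.2 (hp0 s hs)

end Neighbouring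

/-- Theorem 3.1, proximal partial sensitivity relation.
Under (SH), (H1), with `φ` locally Lipschitz, if `x̄` is optimal for the Mayer problem
`P(t₀,x₀)` and `p̄` is an arc solving the Hamiltonian adjoint inclusion with proximal
transversality condition `−p̄(T) ∈ ∂^{+,pr}φ(x̄(T))`, then there are `c₀, r > 0` with
`V(t,x̄(t)+h) − V(t,x̄(t)) ≤ ⟪−p̄(t),h⟫ + c₀|h|²` for all `t ∈ [t₀,T]`, `|h| ≤ r`;
consequently `−p̄(t) ∈ ∂ₓ^{+,pr}V(t,x̄(t))` for all `t ∈ [t₀,T]`. -/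
theorem stmt0 {n : ℕ} (F : Euc n → Set (Euc n)) (φ : Euc n → ℝ)
    (t0 T : ℝ) (x0 : Euc n) (xbar xbar' pbar pbar' : ℝ → Euc n)
    (hSH : StandingHyp F) (hH1 : HypH1 F) (hφ : LocallyLipschitz φ) (ht : t0 < T)
    (hopt : IsOptimal F φ t0 T x0 xbar xbar')
    (hpAC : ACArc t0 T pbar pbar')
    (hadj : ∀ᵐ t ∂volume, t ∈ Icc t0 T →
      -pbar' t ∈ FSub (fun y => Ham F y (pbar t)) (xbar t) ∧
      xbar' t ∈ ClarkeGrad (fun q => Ham F (xbar t) q) (pbar t))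
    (htrans : -pbar T ∈ ProxSuper φ (xbar T)) :
    ∃ c0 > (0:ℝ), ∃ r > (0:ℝ),
      (∀ t ∈ Icc t0 T, ∀ h : Euc n, ‖h‖ ≤ r →
        valueFn F φ T t (xbar t + h) - valueFn F φ T t (xbar t) ≤
          ⟪-pbar t, h⟫ + c0 * ‖h‖ ^ 2) ∧
      (∀ t ∈ Icc t0 T, -pbar t ∈ ProxSuper (fun y => valueFn F φ T t y) (xbar t)) := by
  have hval := hSH.1
  obtain ⟨rg, hrg, hgr⟩ := hSH.2.2
  have hxT := hopt.1
  obtain ⟨R₀, hR₀⟩ := isCompact_Icc.exists_bound_of_continuousOn hxT.1.continuousOn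
  obtain ⟨M, hM⟩ := isCompact_Icc.exists_bound_of_continuousOn hpAC.continuousOn
  have hT : T ∈ Icc t0 T := ⟨ht.le, le_rfl⟩
  have hR₀0 : 0 ≤ R₀ := (norm_nonneg _).trans (hR₀ T hT)
  have hM0 : 0 ≤ M := (norm_nonneg _).trans (hM T hT)
  set K : Set (Euc n) := closedBall 0 (R₀ + 1) with hKdef
  have hKconv : Convex ℝ K := convex_closedBall _ _
  have hKcomp : IsCompact K := isCompact_closedBall _ _
  have hnear : ∀ s ∈ Icc t0 T, ∀ y, ‖y - xbar s‖ ≤ 1 → y ∈ K := fun s hs y hy => by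
    rw [hKdef, mem_closedBall_zero_iff]
    have := norm_add_le (xbar s) (y - xbar s)
    rw [add_sub_cancel] at this
    linarith [hR₀ s hs]
  have hxK : ∀ s ∈ Icc t0 T, xbar s ∈ K := fun s hs => hnear s hs _ (by simp)
  have hKnhds : ∀ s ∈ Icc t0 T, K ∈ 𝓝 (xbar s) := fun s hs =>
    mem_of_superset (closedBall_mem_nhds _ one_pos) fun y hy =>
      hnear s hs y (by rwa [← dist_eq_norm])
  obtain ⟨L, hL, hFL⟩ := hSH.exists_setLipOn hKcomp
  obtain ⟨c, hc, hsc⟩ := hH1.1 K ⟨_, hxK T hT⟩ hKconv hKcomp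
  have hp' : ∀ᵐ s, s ∈ Icc t0 T → ‖pbar' s‖ ≤ L * ‖pbar s‖ := by
    filter_upwards [hadj] with s hs hst
    rw [← norm_neg]
    exact hFL.norm_le_of_mem_fSub hL hval (hKnhds s hst) (hs hst).1
  have hmax : ∀ᵐ s, s ∈ Icc t0 T → ⟪xbar' s, pbar s⟫ = Ham F (xbar s) (pbar s) := by
    filter_upwards [hadj, hxT.2] with s h1 h2 hs
    exact inner_eq_ham_of_mem_clarkeGrad (hval _).1 (hval _).2.2 (h2 hs) (h1 hs).2
  have hp0 : (∀ s ∈ Icc t0 T, pbar s = 0) ∨ ∀ s ∈ Icc t0 T, pbar s ≠ 0 := by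
    by_cases h : ∃ a ∈ Icc t0 T, pbar a = 0
    · obtain ⟨a, ha, h0⟩ := h
      exact Or.inl (hpAC.eq_zero_of_eq_zero hL hp' ha h0)
    · exact Or.inr fun s hs h0 => h ⟨s, hs, h0⟩
  obtain ⟨C, hC, hnb⟩ := exists_traj_near hSH hH1 ht.le hxT hpAC.continuousOn hp0 hmax
  obtain ⟨c₁, hc₁, ρ, hρ, hφ'⟩ := htrans
  have hD : 0 ≤ T - t0 := sub_nonneg.2 ht.le
  have main : ∀ t ∈ Icc t0 T, ∀ h : Euc n, ‖h‖ ≤ min (1 / C) (ρ / C) →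
      valueFn F φ T t (xbar t + h) - valueFn F φ T t (xbar t) ≤
        ⟪-pbar t, h⟫ + (c₁ * C ^ 2 + c * M * C ^ 2 * (T - t0) + 1) * ‖h‖ ^ 2 := by
    intro t htm h hh
    have hh1 : C * ‖h‖ ≤ 1 := by
      have := (le_div_iff₀ hC).1 (hh.trans (min_le_left _ _))
      linarith
    have hhρ : C * ‖h‖ ≤ ρ := by
      have := (le_div_iff₀ hC).1 (hh.trans (min_le_right _ _))
      linarith
    obtain ⟨y, v, hy, hyt, hyx⟩ := hnb t htm h hh1
    have hsub : ∀ s ∈ Icc t T, s ∈ Icc t0 T := fun s hs => ⟨htm.1.trans hs.1, hs.2⟩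
    have hyK : ∀ s ∈ Icc t T, y s ∈ K := fun s hs =>
      hnear s (hsub s hs) _ ((hyx s hs).1.trans hh1)
    have hvel : ∀ z ∈ K, ∀ w ∈ F z, ‖w‖ ≤ rg * (1 + (R₀ + 1)) := fun z hz w hw => by
      rw [hKdef, mem_closedBall_zero_iff] at hz
      exact (hgr z w hw).trans (by gcongr)
    have hinner := ACArc.inner_sub_inner_ge (B := L * M + 2 * (rg * (1 + (R₀ + 1))))
      (K := c * M * C ^ 2 * ‖h‖ ^ 2) htm.2 (hpAC.restrict htm) (hy.1.sub (hxT.1.restrict htm))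
      (by positivity) ?_ ?_ ?_
    · have hTT : T ∈ Icc t T := ⟨htm.2, le_rfl⟩
      have h1 : valueFn F φ T t (xbar t + h) ≤ φ (y T) :=
        hyt ▸ valueFn_le hSH hφ.continuous htm.2 hy
      have h2 := hopt.le_valueFn htm
      have h3 := hφ' (y T) (by
        rw [mem_closedBall, dist_eq_norm]
        exact (hyx T hTT).1.trans hhρ)
      have h4 : c₁ * ‖y T - xbar T‖ ^ 2 ≤ c₁ * (C * ‖h‖) ^ 2 := by
        gcongr
        exact (hyx T hTT).1
      have h5 : c * M * C ^ 2 * ‖h‖ ^ 2 * (T - t) ≤ c * M * C ^ 2 * ‖h‖ ^ 2 * (T - t0) := by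
        have := htm.1
        gcongr
      rw [hyt, add_sub_cancel_left] at hinner
      rw [inner_neg_left] at h3 ⊢
      nlinarith [sq_nonneg ‖h‖]
    · filter_upwards [hp'] with s hs hst
      refine (hs (hsub s hst)).trans ?_
      have h1 := hM s (hsub s hst)
      have h2 : L * ‖pbar s‖ ≤ L * M := by gcongr
      have h3 : 0 ≤ rg * (1 + (R₀ + 1)) := by positivity
      linarith
    · filter_upwards [hy.2, hxT.2] with s h1 h2 hs
      have e1 := hvel _ (hyK s hs) _ (h1 hs)
      have e2 := hvel _ (hxK s (hsub s hs)) _ (h2 (hsub s hs))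
      have e3 : 0 ≤ L * M := by positivity
      linarith [norm_sub_le (v s) (xbar' s)]
    · filter_upwards [hadj, hmax] with s h1 h2 hs
      have hs0 := hsub s hs
      have e1 := (hsc (pbar s)).sub_sub_inner_ge hKconv (by positivity) (hxK s hs0)
        (h := y s - xbar s) (by rw [add_sub_cancel]; exact hyK s hs) (h1 hs0).1
      rw [add_sub_cancel, inner_neg_left] at e1
      have e2 : c * ‖pbar s‖ * ‖y s - xbar s‖ ^ 2 ≤ c * M * (C * ‖h‖) ^ 2 := by
        gcongr
        · exact hM s hs0
        · exact (hyx s hs).1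
      rw [inner_sub_right (pbar s), real_inner_comm (v s), real_inner_comm (xbar' s),
        (hyx s hs).2, h2 hs0]
      linarith
  have hr : 0 < min (1 / C) (ρ / C) := lt_min (by positivity) (by positivity)
  have hc₀ : 0 < c₁ * C ^ 2 + c * M * C ^ 2 * (T - t0) + 1 := by positivity
  refine ⟨_, hc₀, _, hr, main, fun t htm => ⟨_, hc₀.le, _, hr, fun y hy => ?_⟩⟩
  rw [mem_closedBall, dist_eq_norm] at hy
  have := main t htm (y - xbar t) hy
  rw [add_sub_cancel] at this
  exact sub_le_iff_le_add'.2 this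

end
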